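/- For every integer n ≥ 10 there exists a unique f₂ ∈ C^∞((0,∞)) satisfying f₂''(r) + ((n-1)/r)·f₂'(r) + (n(n+2)·U(r)^{4/(n-2)} − 2n/r²)·f₂(r) = −r²·U(r) on (0,∞) with lim_{r→0} f₂(r) = lim_{r→∞} f₂(r) = 0. Moreover, for some positive constant C depending only on n, (U(r)/(6(n−4)))·(r⁴ + ((3n−4)/(n−2))·r²) ≤ f₂(r) ≤ C·r^{3/2}·(1+r)^{9/2−n} for all 0 < r < ∞. -/

import Mathlib

open Set Filter

/-- The standard bubble `U(r) = (1 + r²)^{-(n-2)/2}`. -/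
noncomputable def U (n : ℕ) (r : ℝ) : ℝ := (1 + r ^ 2) ^ (-(((n : ℝ) - 2) / 2))

/-- `f` is a smooth solution of
`f'' + ((n-1)/r) f' + (n(n+2) U^{4/(n-2)} − 2n/r²) f = −r² U` on `(0,∞)`
with `f(r) → 0` as `r → 0⁺` and as `r → ∞`. -/
def IsSolF2 (n : ℕ) (f : ℝ → ℝ) : Prop :=
  ContDiffOn ℝ (⊤ : ℕ∞) f (Ioi 0) ∧
  (∀ r ∈ Ioi (0 : ℝ),
    deriv (deriv f) r + ((n : ℝ) - 1) / r * deriv f r +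
      ((n : ℝ) * ((n : ℝ) + 2) * U n r ^ ((4 : ℝ) / ((n : ℝ) - 2)) - 2 * (n : ℝ) / r ^ 2) * f r
      = -(r ^ 2 * U n r)) ∧
  Tendsto f (nhdsWithin 0 (Ioi 0)) (nhds 0) ∧
  Tendsto f atTop (nhds 0)

open Topology

lemma U_pos (n : ℕ) (r : ℝ) : 0 < U n r := by unfold U; positivity

lemma hasDerivAt_one_add_sq (r : ℝ) : HasDerivAt (fun x : ℝ => 1 + x ^ 2) (2 * r) r := by
  simpa using (hasDerivAt_pow 2 r).const_add 1

lemma hasDerivAt_U (n : ℕ) (r : ℝ) :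
    HasDerivAt (U n) (U n r * (-(((n : ℝ) - 2) * r / (1 + r ^ 2)))) r := by
  have hpos : 0 < 1 + r ^ 2 := by positivity
  have h := (hasDerivAt_one_add_sq r).rpow_const (p := -(((n : ℝ) - 2) / 2)) (Or.inl hpos.ne')
  refine h.congr_deriv ?_
  rw [Real.rpow_sub_one hpos.ne']
  unfold U
  field_simp

lemma HasDerivAt.U_mul {n : ℕ} {q : ℝ → ℝ} {q' r : ℝ} (hq : HasDerivAt q q' r) :
    HasDerivAt (fun x => U n x * q x)
      (U n r * (q' - ((n : ℝ) - 2) * r / (1 + r ^ 2) * q r)) r :=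
  ((hasDerivAt_U n r).mul hq).congr_deriv (by ring)

lemma U_rpow {n : ℕ} (hn : 10 ≤ n) (r : ℝ) :
    U n r ^ ((4 : ℝ) / ((n : ℝ) - 2)) = 1 / (1 + r ^ 2) ^ 2 := by
  have hn' : (10 : ℝ) ≤ n := by exact_mod_cast hn
  have h2 : (n : ℝ) - 2 ≠ 0 := by linarith
  have hpos : 0 < 1 + r ^ 2 := by positivity
  unfold U
  rw [← Real.rpow_mul hpos.le,
    show -(((n : ℝ) - 2) / 2) * (4 / ((n : ℝ) - 2)) = -((2 : ℕ) : ℝ) by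
      push_cast; field_simp; norm_num,
    Real.rpow_neg hpos.le, Real.rpow_natCast, one_div]

lemma contDiff_U (n : ℕ) : ContDiff ℝ (⊤ : ℕ∞) (U n) := by
  unfold U
  exact ContDiff.rpow_const_of_ne (by fun_prop) fun x => by positivity

lemma U_le (n : ℕ) (hn : 2 ≤ n) {r : ℝ} (hr : 0 < r) :
    U n r ≤ 2 ^ (((n : ℝ) - 2) / 2) * (1 + r) ^ (2 - (n : ℝ)) := by
  have hn' : (2 : ℝ) ≤ n := by exact_mod_cast hn
  have h1 : 0 < 1 + r := by positivity
  have hle : (1 + r) ^ 2 / 2 ≤ 1 + r ^ 2 := by nlinarith [sq_nonneg (1 - r)]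
  have h := Real.rpow_le_rpow_of_nonpos (by positivity) hle
    (show -(((n : ℝ) - 2) / 2) ≤ 0 by linarith)
  refine h.trans_eq ?_
  rw [Real.div_rpow (by positivity) (by norm_num), ← Real.rpow_natCast (1 + r) 2,
    ← Real.rpow_mul h1.le, Real.rpow_neg (by norm_num : (0 : ℝ) ≤ 2), div_inv_eq_mul, mul_comm]
  congr 2
  push_cast
  ring

/-- The solution divided by the bubble. -/
noncomputable def solProfile (N r : ℝ) : ℝ :=
  1 / (6 * (N - 4)) * (r ^ 4 + (3 * N - 4) / (N - 2) * r ^ 2) +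
    2 * (N - 1) / (3 * (N - 2) * (N - 4)) * (r ^ 2 / (1 + r ^ 2))

/-- The derivative of `solProfile`. -/
noncomputable def solProfileDeriv (N r : ℝ) : ℝ :=
  1 / (6 * (N - 4)) * (4 * r ^ 3 + (3 * N - 4) / (N - 2) * (2 * r)) +
    2 * (N - 1) / (3 * (N - 2) * (N - 4)) * (2 * r / (1 + r ^ 2) ^ 2)

/-- The second derivative of `solProfile`. -/
noncomputable def solProfileDeriv₂ (N r : ℝ) : ℝ :=
  1 / (6 * (N - 4)) * (12 * r ^ 2 + (3 * N - 4) / (N - 2) * 2) +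
    2 * (N - 1) / (3 * (N - 2) * (N - 4)) * ((2 - 6 * r ^ 2) / (1 + r ^ 2) ^ 3)

lemma hasDerivAt_solProfile (N r : ℝ) :
    HasDerivAt (solProfile N) (solProfileDeriv N r) r := by
  have hpos : 1 + r ^ 2 ≠ 0 := by positivity
  have h2 := hasDerivAt_pow 2 r
  have h := (((hasDerivAt_pow 4 r).add (h2.const_mul ((3 * N - 4) / (N - 2)))).const_mul
    (1 / (6 * (N - 4)))).add
    ((h2.div (hasDerivAt_one_add_sq r) hpos).const_mul (2 * (N - 1) / (3 * (N - 2) * (N - 4))))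
  refine h.congr_deriv ?_
  unfold solProfileDeriv
  congr 2
  · norm_num
  · congr 1
    norm_num
    ring

lemma hasDerivAt_solProfileDeriv (N r : ℝ) :
    HasDerivAt (solProfileDeriv N) (solProfileDeriv₂ N r) r := by
  have hpos : 1 + r ^ 2 ≠ 0 := by positivity
  have hid : HasDerivAt (fun x : ℝ => 2 * x) 2 r := by
    simpa using (hasDerivAt_id r).const_mul 2
  have h := ((((hasDerivAt_pow 3 r).const_mul 4).add
    (hid.const_mul ((3 * N - 4) / (N - 2)))).const_mul (1 / (6 * (N - 4)))).add
    ((hid.div ((hasDerivAt_one_add_sq r).pow 2) (pow_ne_zero 2 hpos)).const_mul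
      (2 * (N - 1) / (3 * (N - 2) * (N - 4))))
  refine h.congr_deriv ?_
  unfold solProfileDeriv₂
  congr 2
  · norm_num
    ring
  · simp only [Pi.pow_apply]
    field_simp
    norm_num
    ring

/-- The explicit solution. -/
noncomputable def sol (n : ℕ) (r : ℝ) : ℝ := U n r * solProfile n r

lemma hasDerivAt_sol (n : ℕ) (r : ℝ) :
    HasDerivAt (sol n) (U n r * (solProfileDeriv n r -
      ((n : ℝ) - 2) * r / (1 + r ^ 2) * solProfile n r)) r :=
  (hasDerivAt_solProfile n r).U_mul

lemma sol_ode {n : ℕ} (hn : 10 ≤ n) {r : ℝ} (hr : 0 < r) :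
    deriv (deriv (sol n)) r + ((n : ℝ) - 1) / r * deriv (sol n) r +
      ((n : ℝ) * ((n : ℝ) + 2) * U n r ^ ((4 : ℝ) / ((n : ℝ) - 2)) - 2 * (n : ℝ) / r ^ 2) * sol n r
      = -(r ^ 2 * U n r) := by
  have hn' : (10 : ℝ) ≤ n := by exact_mod_cast hn
  have hpos : 1 + r ^ 2 ≠ 0 := by positivity
  have hcoef : HasDerivAt (fun x : ℝ => ((n : ℝ) - 2) * x / (1 + x ^ 2))
      (((n : ℝ) - 2) * (1 - r ^ 2) / (1 + r ^ 2) ^ 2) r := by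
    have h := (((hasDerivAt_id r).const_mul ((n : ℝ) - 2)).div (hasDerivAt_one_add_sq r) hpos)
    refine h.congr_deriv ?_
    simp only [id]
    field_simp
    ring
  have hd := ((hasDerivAt_solProfileDeriv n r).sub
    (hcoef.mul (hasDerivAt_solProfile n r))).U_mul (n := n)
  have hderiv : deriv (sol n) = fun x => U n x * ((solProfileDeriv (n : ℝ) -
      (fun x : ℝ => ((n : ℝ) - 2) * x / (1 + x ^ 2)) * solProfile (n : ℝ) : ℝ → ℝ) x) := by
    funext x
    exact (hasDerivAt_sol n x).deriv
  rw [hderiv, hd.deriv, U_rpow hn]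
  simp only [Pi.sub_apply, Pi.mul_apply, sol]
  have hU := (U_pos n r).ne'
  have h2 : (n : ℝ) - 2 ≠ 0 := by linarith
  have h4 : (n : ℝ) - 4 ≠ 0 := by linarith
  generalize (n : ℝ) = N at *
  generalize U n r = u at *
  unfold solProfile solProfileDeriv solProfileDeriv₂
  field_simp
  ring

lemma contDiff_sol (n : ℕ) : ContDiff ℝ (⊤ : ℕ∞) (sol n) := by
  refine (contDiff_U n).mul ?_
  unfold solProfile
  refine ContDiff.add (by fun_prop)
    (contDiff_const.mul (ContDiff.div (by fun_prop) (by fun_prop) ?_))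
  intro x
  positivity

lemma le_sol {n : ℕ} (hn : 10 ≤ n) (r : ℝ) :
    U n r / (6 * ((n : ℝ) - 4)) * (r ^ 4 + (3 * (n : ℝ) - 4) / ((n : ℝ) - 2) * r ^ 2) ≤ sol n r := by
  have hn' : (10 : ℝ) ≤ n := by exact_mod_cast hn
  have h1 : 0 ≤ (n : ℝ) - 1 := by linarith
  have h2 : 0 ≤ (n : ℝ) - 2 := by linarith
  have h4 : 0 ≤ (n : ℝ) - 4 := by linarith
  have hrest : 0 ≤ U n r * (2 * ((n : ℝ) - 1) / (3 * ((n : ℝ) - 2) * ((n : ℝ) - 4)) *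
      (r ^ 2 / (1 + r ^ 2))) := mul_nonneg (U_pos n r).le (by positivity)
  unfold sol solProfile
  rw [mul_add (U n r)]
  refine le_add_of_le_of_nonneg (le_of_eq ?_) hrest
  ring

lemma sol_nonneg {n : ℕ} (hn : 10 ≤ n) (r : ℝ) : 0 ≤ sol n r := by
  have hn' : (10 : ℝ) ≤ n := by exact_mod_cast hn
  refine le_trans ?_ (le_sol hn r)
  have h2 : 0 ≤ (n : ℝ) - 2 := by linarith
  have h3 : 0 ≤ 3 * (n : ℝ) - 4 := by linarith
  have h4 : 0 ≤ (n : ℝ) - 4 := by linarith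
  have := (U_pos n r).le
  positivity

lemma exists_sol_le {n : ℕ} (hn : 10 ≤ n) : ∃ C : ℝ, 0 < C ∧ ∀ r ∈ Ioi (0 : ℝ),
    sol n r ≤ C * r ^ ((3 : ℝ) / 2) * (1 + r) ^ ((9 : ℝ) / 2 - (n : ℝ)) := by
  have hn' : (10 : ℝ) ≤ n := by exact_mod_cast hn
  have h1 : 0 < (n : ℝ) - 1 := by linarith
  have h2 : 0 < (n : ℝ) - 2 := by linarith
  have h3 : 0 < 3 * (n : ℝ) - 4 := by linarith
  have h4 : 0 < (n : ℝ) - 4 := by linarith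
  obtain ⟨a, ha⟩ : ∃ a, a = 1 / (6 * ((n : ℝ) - 4)) := ⟨_, rfl⟩
  obtain ⟨b, hb⟩ : ∃ b, b = (3 * (n : ℝ) - 4) / ((n : ℝ) - 2) := ⟨_, rfl⟩
  obtain ⟨c, hc⟩ : ∃ c, c = 2 * ((n : ℝ) - 1) / (3 * ((n : ℝ) - 2) * ((n : ℝ) - 4)) := ⟨_, rfl⟩
  have ha0 : 0 < a := by rw [ha]; positivity
  have hb0 : 0 < b := by rw [hb]; positivity
  have hc0 : 0 < c := by rw [hc]; positivity
  refine ⟨2 ^ (((n : ℝ) - 2) / 2) * (a + a * b + c), by positivity, fun r hr => ?_⟩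
  have hr : 0 < r := hr
  have hr1 : 0 < 1 + r := by positivity
  have hfrac : r ^ 2 / (1 + r ^ 2) ≤ r ^ 2 :=
    div_le_self (by positivity) (le_add_of_nonneg_right (by positivity))
  have hprofile : solProfile n r ≤ (a + a * b + c) * (r ^ 4 + r ^ 2) := by
    unfold solProfile
    rw [← ha, ← hb, ← hc]
    have hab : 0 ≤ a * b * r ^ 4 := by positivity
    have har : 0 ≤ a * r ^ 2 := by positivity
    have hcr : 0 ≤ c * r ^ 4 := by positivity
    nlinarith [mul_le_mul_of_nonneg_left hfrac hc0.le]
  have hsqrt : r ^ 2 = r ^ ((3 : ℝ) / 2) * r ^ ((1 : ℝ) / 2) := by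
    rw [← Real.rpow_add hr, ← Real.rpow_natCast]
    norm_num
  have hpow : r ^ 4 + r ^ 2 ≤ r ^ ((3 : ℝ) / 2) * (1 + r) ^ ((5 : ℝ) / 2) := by
    have hsplit : (1 + r) ^ ((5 : ℝ) / 2) = (1 + r) ^ ((1 : ℝ) / 2) * (1 + r) ^ 2 := by
      rw [← Real.rpow_natCast (1 + r) 2, ← Real.rpow_add hr1]
      norm_num
    calc r ^ 4 + r ^ 2 = r ^ ((3 : ℝ) / 2) * (r ^ ((1 : ℝ) / 2) * (r ^ 2 + 1)) := by
          rw [← mul_assoc, ← hsqrt]; ring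
      _ ≤ r ^ ((3 : ℝ) / 2) * ((1 + r) ^ ((1 : ℝ) / 2) * (1 + r) ^ 2) := by
          gcongr
          · linarith
          · nlinarith
      _ = _ := by rw [hsplit]
  calc sol n r = U n r * solProfile n r := rfl
    _ ≤ (2 ^ (((n : ℝ) - 2) / 2) * (1 + r) ^ (2 - (n : ℝ))) *
        ((a + a * b + c) * (r ^ ((3 : ℝ) / 2) * (1 + r) ^ ((5 : ℝ) / 2))) := by
        refine (mul_le_mul_of_nonneg_left (hprofile.trans
          (mul_le_mul_of_nonneg_left hpow (by positivity))) (U_pos n r).le).trans ?_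
        exact mul_le_mul_of_nonneg_right (U_le n (by omega) hr) (by positivity)
    _ = _ := by
        rw [show (9 : ℝ) / 2 - n = 5 / 2 + (2 - n) by ring, Real.rpow_add hr1]
        ring

lemma tendsto_sol_atTop {n : ℕ} (hn : 10 ≤ n) : Tendsto (sol n) atTop (𝓝 0) := by
  have hn' : (10 : ℝ) ≤ n := by exact_mod_cast hn
  obtain ⟨C, hC, hle⟩ := exists_sol_le hn
  have hlim : Tendsto (fun r : ℝ => C * (1 + r) ^ (-((n : ℝ) - 6))) atTop (𝓝 0) := by
    have h := (tendsto_rpow_neg_atTop (show 0 < (n : ℝ) - 6 by linarith)).comp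
      (tendsto_atTop_add_const_left atTop (1 : ℝ) tendsto_id)
    simpa using h.const_mul C
  refine tendsto_of_tendsto_of_tendsto_of_le_of_le' tendsto_const_nhds hlim
    (Eventually.of_forall (sol_nonneg hn)) ?_
  filter_upwards [eventually_gt_atTop 0] with r hr
  have hr1 : 0 < 1 + r := by positivity
  refine (hle r hr).trans ?_
  rw [show -((n : ℝ) - 6) = 3 / 2 + (9 / 2 - n) by ring, Real.rpow_add hr1, mul_assoc]
  gcongr
  linarith

lemma isSolF2_sol {n : ℕ} (hn : 10 ≤ n) : IsSolF2 n (sol n) := by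
  refine ⟨(contDiff_sol n).contDiffOn, fun r hr => sol_ode hn hr, ?_, tendsto_sol_atTop hn⟩
  have h := ((contDiff_sol n).continuous.tendsto 0).mono_left
    (nhdsWithin_le_nhds (s := Ioi (0 : ℝ)))
  simpa [sol, solProfile] using h

lemma MonotoneOn.eqOn_zero_of_tendsto {w : ℝ → ℝ} (hw : MonotoneOn w (Ioi 0))
    (h0 : Tendsto w (𝓝[>] 0) (𝓝 0)) (hinf : Tendsto w atTop (𝓝 0)) :
    EqOn w 0 (Ioi 0) := by
  intro x hx
  refine le_antisymm ?_ ?_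
  · refine ge_of_tendsto hinf ?_
    filter_upwards [eventually_ge_atTop x] with y hy
    exact hw hx (lt_of_lt_of_le (mem_Ioi.1 hx) hy) hy
  · refine le_of_tendsto h0 ?_
    filter_upwards [Ioo_mem_nhdsGT (mem_Ioi.1 hx)] with y hy
    exact hw hy.1 hx hy.2.le

/-- The reciprocal of the solution `r⁻ⁿ (1 + r²)^{(n+2)/2}` of the homogeneous equation. -/
noncomputable def weight (n : ℕ) (r : ℝ) : ℝ := U n r * (r ^ n / (1 + r ^ 2) ^ 2)

lemma weight_pos (n : ℕ) {r : ℝ} (hr : 0 < r) : 0 < weight n r :=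
  mul_pos (U_pos n r) (by positivity)

lemma weight_le_one {n : ℕ} {r : ℝ} (hr : 0 < r) : weight n r ≤ 1 := by
  have hpos : 0 < 1 + r ^ 2 := by positivity
  have hrn : r ^ n ≤ (1 + r ^ 2) ^ ((n : ℝ) / 2) := by
    calc r ^ n = (r ^ 2) ^ ((n : ℝ) / 2) := by
          rw [← Real.rpow_natCast r 2, ← Real.rpow_mul hr.le, ← Real.rpow_natCast]
          congr 1
          push_cast
          ring
      _ ≤ _ := by gcongr; linarith
  have hU : U n r * (1 + r ^ 2) ^ ((n : ℝ) / 2) = 1 + r ^ 2 := by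
    unfold U
    rw [← Real.rpow_add hpos, show -(((n : ℝ) - 2) / 2) + (n : ℝ) / 2 = 1 by ring, Real.rpow_one]
  calc weight n r = U n r * r ^ n / (1 + r ^ 2) ^ 2 := by unfold weight; ring
    _ ≤ (1 + r ^ 2) / (1 + r ^ 2) ^ 2 := by
        gcongr
        exact (mul_le_mul_of_nonneg_left hrn (U_pos n r).le).trans_eq hU
    _ ≤ 1 := by
        rw [div_le_one (by positivity)]
        nlinarith [sq_nonneg r]

lemma hasDerivAt_weight (n : ℕ) {r : ℝ} (hr : 0 < r) :
    HasDerivAt (weight n) (weight n r * ((n : ℝ) / r - ((n : ℝ) + 2) * r / (1 + r ^ 2))) r := by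
  have hpos : 1 + r ^ 2 ≠ 0 := by positivity
  have h := (((hasDerivAt_pow n r).div ((hasDerivAt_one_add_sq r).pow 2)
    (pow_ne_zero 2 hpos))).U_mul (n := n)
  refine h.congr_deriv ?_
  have hrn : (n : ℝ) * r ^ (n - 1) = n * r ^ n / r := by
    rcases n with _ | n
    · simp
    · field_simp
      simp [pow_succ]
  rw [hrn]
  simp only [weight, Pi.div_apply, Pi.pow_apply]
  field_simp
  norm_num
  ring

/-- A factor turning `d' + (log weight)' d` into a constant for homogeneous solutions `d`. -/
noncomputable def wronskianFactor (n : ℕ) (r : ℝ) : ℝ := (1 + r ^ 2) ^ 2 / r / U n r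

lemma wronskianFactor_pos (n : ℕ) {r : ℝ} (hr : 0 < r) : 0 < wronskianFactor n r :=
  div_pos (by positivity) (U_pos n r)

lemma hasDerivAt_wronskianFactor (n : ℕ) {r : ℝ} (hr : 0 < r) :
    HasDerivAt (wronskianFactor n)
      (wronskianFactor n r * (((n : ℝ) + 2) * r / (1 + r ^ 2) - 1 / r)) r := by
  have hpos : 1 + r ^ 2 ≠ 0 := by positivity
  have hU := (U_pos n r).ne'
  have h := (((hasDerivAt_one_add_sq r).pow 2).div (hasDerivAt_id r) hr.ne').div
    (hasDerivAt_U n r) hU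
  refine h.congr_deriv ?_
  simp only [wronskianFactor, Pi.div_apply, Pi.pow_apply, id]
  field_simp
  norm_num
  ring

lemma eqOn_zero_of_homogeneous {n : ℕ} {d d₁ d₂ : ℝ → ℝ}
    (hd : ∀ r ∈ Ioi (0 : ℝ), HasDerivAt d (d₁ r) r)
    (hd₁ : ∀ r ∈ Ioi (0 : ℝ), HasDerivAt d₁ (d₂ r) r)
    (hode : ∀ r ∈ Ioi (0 : ℝ), d₂ r + ((n : ℝ) - 1) / r * d₁ r +
      ((n : ℝ) * ((n : ℝ) + 2) * (1 / (1 + r ^ 2) ^ 2) - 2 * (n : ℝ) / r ^ 2) * d r = 0)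
    (h0 : Tendsto d (𝓝[>] 0) (𝓝 0)) (hinf : Tendsto d atTop (𝓝 0)) :
    EqOn d 0 (Ioi 0) := by
  let ℓ : ℝ → ℝ := fun r => (n : ℝ) / r - ((n : ℝ) + 2) * r / (1 + r ^ 2)
  let W : ℝ → ℝ := fun r => wronskianFactor n r * (d₁ r + d r * ℓ r)
  let w : ℝ → ℝ := fun r => d r * weight n r
  have hℓ : ∀ r ∈ Ioi (0 : ℝ), HasDerivAt ℓ
      (-(n : ℝ) / r ^ 2 - ((n : ℝ) + 2) * (1 - r ^ 2) / (1 + r ^ 2) ^ 2) r := by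
    intro r hr
    have hr : 0 < r := hr
    have hpos : 1 + r ^ 2 ≠ 0 := by positivity
    have h := ((hasDerivAt_const r (n : ℝ)).div (hasDerivAt_id r) hr.ne').sub
      (((hasDerivAt_id r).const_mul ((n : ℝ) + 2)).div (hasDerivAt_one_add_sq r) hpos)
    refine h.congr_deriv ?_
    simp only [id]
    field_simp
    ring
  have hW : ∀ r ∈ Ioi (0 : ℝ), HasDerivAt W 0 r := by
    intro r hr
    have h := (hasDerivAt_wronskianFactor n hr).mul ((hd₁ r hr).add ((hd r hr).mul (hℓ r hr)))
    refine h.congr_deriv ?_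
    have hr : 0 < r := hr
    have hpos : 1 + r ^ 2 ≠ 0 := by positivity
    have hd₂ := eq_neg_of_add_eq_zero_left ((add_assoc _ _ _).symm.trans (hode r hr))
    simp only [Pi.add_apply, Pi.mul_apply, ℓ]
    rw [hd₂]
    field_simp
    ring
  have hWconst : ∀ r ∈ Ioi (0 : ℝ), W r = W 1 := by
    intro r hr
    refine (convex_Ioi (0 : ℝ)).is_const_of_fderivWithin_eq_zero (𝕜 := ℝ)
      (fun x hx => (hW x hx).differentiableAt.differentiableWithinAt) ?_ hr (mem_Ioi.2 one_pos)
    intro x hx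
    have := (hW x hx).hasFDerivAt.hasFDerivWithinAt (s := Ioi 0)
    rw [this.fderivWithin (uniqueDiffOn_Ioi 0 x hx)]
    ext
    simp
  have hw : ∀ r ∈ Ioi (0 : ℝ), HasDerivAt w (W 1 * (weight n r / wronskianFactor n r)) r := by
    intro r hr
    refine ((hd r hr).mul (hasDerivAt_weight n hr)).congr_deriv ?_
    have := (wronskianFactor_pos n hr).ne'
    rw [← hWconst r hr]
    simp only [W, ℓ]
    generalize (n : ℝ) / r - ((n : ℝ) + 2) * r / (1 + r ^ 2) = l
    field_simp
  have hlim : ∀ {F : Filter ℝ}, Tendsto d F (𝓝 0) → (∀ᶠ r in F, 0 < r) → Tendsto w F (𝓝 0) := by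
    intro F hF hev
    refine squeeze_zero_norm' ?_ (by simpa using hF.norm)
    filter_upwards [hev] with r hr
    rw [norm_mul, Real.norm_of_nonneg (weight_pos n hr).le]
    exact mul_le_of_le_one_right (norm_nonneg _) (weight_le_one hr)
  have hw0 := hlim h0 self_mem_nhdsWithin
  have hwinf := hlim hinf (eventually_gt_atTop 0)
  have hmono : ∀ s : ℝ, 0 ≤ s * W 1 → MonotoneOn (fun r => s * w r) (Ioi 0) := by
    intro s hs
    have hsw : ∀ r ∈ Ioi (0 : ℝ), HasDerivAt (fun r => s * w r)
        (s * (W 1 * (weight n r / wronskianFactor n r))) r := fun r hr => (hw r hr).const_mul s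
    refine monotoneOn_of_deriv_nonneg (convex_Ioi 0)
      (fun r hr => (hsw r hr).continuousAt.continuousWithinAt)
      (fun r hr => (hsw r (interior_subset hr)).differentiableAt.differentiableWithinAt) ?_
    intro r hr
    have hr := interior_subset hr
    rw [(hsw r hr).deriv, ← mul_assoc]
    exact mul_nonneg hs (div_pos (weight_pos n hr) (wronskianFactor_pos n hr)).le
  obtain ⟨s, hs0, hs⟩ : ∃ s : ℝ, s ≠ 0 ∧ 0 ≤ s * W 1 := by
    rcases le_total 0 (W 1) with h | h
    · exact ⟨1, one_ne_zero, by linarith⟩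
    · exact ⟨-1, by norm_num, by linarith⟩
  have hzero := (hmono s hs).eqOn_zero_of_tendsto (by simpa using hw0.const_mul s)
    (by simpa using hwinf.const_mul s)
  intro r hr
  have h : s * (d r * weight n r) = 0 := hzero hr
  simpa [hs0, (weight_pos n hr).ne'] using h

lemma IsSolF2.hasDerivAt {n : ℕ} {f : ℝ → ℝ} (hf : IsSolF2 n f) {r : ℝ} (hr : r ∈ Ioi (0 : ℝ)) :
    HasDerivAt f (deriv f r) r ∧ HasDerivAt (deriv f) (deriv (deriv f) r) r := by
  have hnhds := isOpen_Ioi.mem_nhds hr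
  have h' : ContDiffOn ℝ 1 (deriv f) (Ioi 0) :=
    ((contDiffOn_infty_iff_deriv_of_isOpen isOpen_Ioi).1 hf.1).2.of_le
      (by exact_mod_cast le_top)
  exact ⟨((hf.1.differentiableOn (by simp)).differentiableAt hnhds).hasDerivAt,
    ((h'.differentiableOn one_ne_zero).differentiableAt hnhds).hasDerivAt⟩

lemma IsSolF2.eqOn {n : ℕ} (hn : 10 ≤ n) {f g : ℝ → ℝ} (hf : IsSolF2 n f) (hg : IsSolF2 n g) :
    EqOn g f (Ioi 0) := by
  have h := eqOn_zero_of_homogeneous (n := n) (d := fun r => g r - f r)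
    (fun r hr => (hg.hasDerivAt hr).1.sub (hf.hasDerivAt hr).1)
    (fun r hr => (hg.hasDerivAt hr).2.sub (hf.hasDerivAt hr).2) ?_
    (by simpa using hg.2.2.1.sub hf.2.2.1) (by simpa using hg.2.2.2.sub hf.2.2.2)
  · exact fun r hr => sub_eq_zero.1 (h hr)
  · intro r hr
    rw [← U_rpow hn]
    linear_combination hg.2.1 r hr - hf.2.1 r hr

/-- for `n ≥ 10` there is a unique smooth solution `f₂` of
`f₂'' + ((n-1)/r) f₂' + (n(n+2) U^{4/(n-2)} − 2n/r²) f₂ = −r² U` vanishing at `0` and `∞`,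
and it satisfies
`(U/(6(n−4)))(r⁴ + ((3n−4)/(n−2)) r²) ≤ f₂(r) ≤ C r^{3/2} (1+r)^{9/2−n}`. -/
theorem statement3 (n : ℕ) (hn : 10 ≤ n) :
    ∃ f₂ : ℝ → ℝ, IsSolF2 n f₂ ∧
      (∀ g : ℝ → ℝ, IsSolF2 n g → EqOn g f₂ (Ioi 0)) ∧
      ∃ C : ℝ, 0 < C ∧ ∀ r ∈ Ioi (0 : ℝ),
        U n r / (6 * ((n : ℝ) - 4)) * (r ^ 4 + (3 * (n : ℝ) - 4) / ((n : ℝ) - 2) * r ^ 2)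
            ≤ f₂ r ∧
          f₂ r ≤ C * r ^ ((3 : ℝ) / 2) * (1 + r) ^ ((9 : ℝ) / 2 - (n : ℝ)) := by
  obtain ⟨C, hC, hle⟩ := exists_sol_le hn
  exact ⟨sol n, isSolF2_sol hn, fun g hg => (isSolF2_sol hn).eqOn hn hg, C, hC,
    fun r hr => ⟨le_sol hn r, hle r hr⟩⟩
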